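/- Assume (H1)–(H6). Then among the minimizers of the unbalanced optimal transport problem inf{⟨c,γ⟩ + F(Aγ) : γ ⪰ 0} there is a unique one, γ*, of minimal discrete entropy H; the trajectory t ↦ γ(t) of minimizers of C_t converges to γ* as t → +∞ and is continuously differentiable on (0, +∞). -/

import Mathlib

open scoped BigOperators
open Filter

noncomputable section

variable {X Y : Type*}

/-- The marginal map `A`. -/
def margA [Fintype X] [Fintype Y] (γ : X × Y → ℝ) : (X → ℝ) × (Y → ℝ) :=
  (fun x => ∑ y, γ (x, y), fun y => ∑ x, γ (x, y))

/-- The adjoint map `A*`. -/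
def adjA (ξ : (X → ℝ) × (Y → ℝ)) : X × Y → ℝ := fun p => ξ.1 p.1 + ξ.2 p.2


/-- The adjoint map `A*` as a linear map. -/
def adjAlin (X Y : Type*) : ((X → ℝ) × (Y → ℝ)) →ₗ[ℝ] (X × Y → ℝ) where
  toFun ξ := fun p => ξ.1 p.1 + ξ.2 p.2
  map_add' u v := by
    funext p
    show (u.1 + v.1) p.1 + (u.2 + v.2) p.2 = _
    simp [Pi.add_apply]
    ring
  map_smul' a v := by
    funext p
    show (a • v.1) p.1 + (a • v.2) p.2 = _
    simp [Pi.smul_apply, smul_eq_mul]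
    ring

/-- Inner product on `ℝ^{X×Y}`. -/
def dotP [Fintype X] [Fintype Y] (c γ : X × Y → ℝ) : ℝ := ∑ p, c p * γ p

/-- Inner product on `ℝ^X ⊕ ℝ^Y`. -/
def dotE [Fintype X] [Fintype Y] (u v : (X → ℝ) × (Y → ℝ)) : ℝ :=
  ∑ x, u.1 x * v.1 x + ∑ y, u.2 y * v.2 y

/-- The discrete entropy. -/
def ent [Fintype X] [Fintype Y] (γ : X × Y → ℝ) : EReal :=
  if ∀ p, 0 ≤ γ p then (((∑ p, γ p * (Real.log (γ p) - 1)) : ℝ) : EReal) else ⊤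

/-- Fenchel conjugate of an `EReal`-valued function. -/
def conj [Fintype X] [Fintype Y] (F : (X → ℝ) × (Y → ℝ) → EReal)
    (ξ : (X → ℝ) × (Y → ℝ)) : EReal :=
  ⨆ v, ((dotE v ξ : ℝ) : EReal) - F v

/-- The regularized primal functional `C_t`. -/
def Ct [Fintype X] [Fintype Y] (F : (X → ℝ) × (Y → ℝ) → EReal) (c : X × Y → ℝ)
    (t : ℝ) (γ : X × Y → ℝ) : EReal :=
  ((dotP c γ : ℝ) : EReal) + F (margA γ) + ((1 / t : ℝ) : EReal) * ent γ

/-- The regularized dual functional `K_t` (`EReal`-valued version). -/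
def KtE [Fintype X] [Fintype Y] (F : (X → ℝ) × (Y → ℝ) → EReal) (c : X × Y → ℝ)
    (t : ℝ) (ξ : (X → ℝ) × (Y → ℝ)) : EReal :=
  conj F (-ξ) + (((1 / t) * ∑ p, Real.exp (t * (adjA ξ p - c p)) : ℝ) : EReal)

/-- The regularized dual functional `K_t` (real-valued version, for a real-valued `F*`). -/
def KtR [Fintype X] [Fintype Y] (Fs : (X → ℝ) × (Y → ℝ) → ℝ) (c : X × Y → ℝ)
    (t : ℝ) (ξ : (X → ℝ) × (Y → ℝ)) : ℝ :=
  Fs (-ξ) + (1 / t) * ∑ p, Real.exp (t * (adjA ξ p - c p))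

/-- (H1): `F` proper, convex, lower semicontinuous. -/
def H1 (F : (X → ℝ) × (Y → ℝ) → EReal) : Prop :=
  (∀ v, F v ≠ ⊥) ∧ (∃ v, F v ≠ ⊤) ∧
  (∀ v w : (X → ℝ) × (Y → ℝ), ∀ a b : ℝ, 0 ≤ a → 0 ≤ b → a + b = 1 →
    F (a • v + b • w) ≤ (a : EReal) * F v + (b : EReal) * F w) ∧
  LowerSemicontinuous F

/-- (H2): there is a strictly positive point in the domain of `F`. -/
def H2 (F : (X → ℝ) × (Y → ℝ) → EReal) : Prop :=
  ∃ v : (X → ℝ) × (Y → ℝ), (∀ x, 0 < v.1 x) ∧ (∀ y, 0 < v.2 y) ∧ F v ≠ ⊤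

/-- (H3): `F` is superlinear at infinity. -/
def H3 [Fintype X] [Fintype Y] (F : (X → ℝ) × (Y → ℝ) → EReal) : Prop :=
  ∀ M : ℝ, ∃ R : ℝ, ∀ v, R ≤ ‖v‖ → ((M * ‖v‖ : ℝ) : EReal) ≤ F v

/-- (H4): a neighborhood of the origin intersected with the nonnegative orthant
lies in the domain of `F`. -/
def H4 (F : (X → ℝ) × (Y → ℝ) → EReal) : Prop :=
  ∃ W ∈ nhds (0 : (X → ℝ) × (Y → ℝ)),
    ∀ v ∈ W, (∀ x, 0 ≤ v.1 x) → (∀ y, 0 ≤ v.2 y) → F v ≠ ⊤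

/-- (H5): strong convexity at every point (for the real-valued conjugate). -/
def H5 [Fintype X] [Fintype Y] (Fs : (X → ℝ) × (Y → ℝ) → ℝ) : Prop :=
  ∀ ξ₀ : (X → ℝ) × (Y → ℝ), ∃ r > (0 : ℝ), ∃ g : (X → ℝ) × (Y → ℝ), ∃ lam > (0 : ℝ),
    (∀ ξ, Fs ξ₀ + dotE g (ξ - ξ₀) ≤ Fs ξ) ∧
    (∀ ξ, ‖ξ - ξ₀‖ ≤ r → Fs ξ₀ + dotE g (ξ - ξ₀) + lam / 2 * ‖ξ - ξ₀‖ ^ 2 ≤ Fs ξ)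

/-- `Fs` is the (real-valued) Fenchel conjugate of `F`. -/
def IsConjOf [Fintype X] [Fintype Y] (F : (X → ℝ) × (Y → ℝ) → EReal)
    (Fs : (X → ℝ) × (Y → ℝ) → ℝ) : Prop :=
  ∀ ξ, (Fs ξ : EReal) = conj F ξ

end

section EntropicTransport

open Topology

variable {X Y : Type*}

lemma H4.zero_ne_top {F : (X → ℝ) × (Y → ℝ) → EReal} (h : H4 F) : F 0 ≠ ⊤ := by
  obtain ⟨W, hW, h⟩ := h
  exact h 0 (mem_of_mem_nhds hW) (fun _ => le_rfl) fun _ => le_rfl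

lemma isClosed_setOf_forall_nonneg : IsClosed {γ : X × Y → ℝ | ∀ p, 0 ≤ γ p} :=
  isClosed_Ici (a := (0 : X × Y → ℝ))

/-- Evaluation of `adjA` at a point, as a continuous linear form. -/
noncomputable def adjAEval (p : X × Y) : ((X → ℝ) × (Y → ℝ)) →L[ℝ] ℝ :=
  (ContinuousLinearMap.proj p.1).comp (ContinuousLinearMap.fst ℝ (X → ℝ) (Y → ℝ)) +
    (ContinuousLinearMap.proj p.2).comp (ContinuousLinearMap.snd ℝ (X → ℝ) (Y → ℝ))

lemma adjAEval_apply (p : X × Y) (ξ : (X → ℝ) × (Y → ℝ)) : adjAEval p ξ = adjA ξ p := rfl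

/-- The coupling associated with a dual variable. -/
noncomputable def gibbs (c : X × Y → ℝ) (t : ℝ) (ξ : (X → ℝ) × (Y → ℝ)) : X × Y → ℝ :=
  fun p => Real.exp (t * (adjA ξ p - c p))

variable [Fintype X] [Fintype Y]

/-- The real value of the discrete entropy at nonnegative vectors. -/
noncomputable def entropyReal (γ : X × Y → ℝ) : ℝ := ∑ p, γ p * (Real.log (γ p) - 1)

/-- The unbalanced transport cost `⟨c, γ⟩ + F (A γ)`. -/
noncomputable def transportCost (F : (X → ℝ) × (Y → ℝ) → EReal) (c γ : X × Y → ℝ) : EReal :=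
  ((dotP c γ : ℝ) : EReal) + F (margA γ)

lemma ent_eq_coe {γ : X × Y → ℝ} (h : ∀ p, 0 ≤ γ p) : ent γ = (entropyReal γ : EReal) :=
  if_pos h

lemma ent_eq_top {γ : X × Y → ℝ} (h : ¬ ∀ p, 0 ≤ γ p) : ent γ = ⊤ := if_neg h

lemma EReal.exists_eq_coe {x : EReal} (hb : x ≠ ⊥) (ht : x ≠ ⊤) : ∃ r : ℝ, x = r :=
  ⟨x.toReal, (EReal.coe_toReal ht hb).symm⟩

/-- Fenchel–Young inequality for the entropy function. -/
lemma mul_sub_exp_le {s : ℝ} (hs : 0 ≤ s) (a : ℝ) :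
    a * s - Real.exp a ≤ s * (Real.log s - 1) := by
  rcases hs.eq_or_lt with rfl | hs
  · simp [Real.exp_nonneg]
  · have h := Real.add_one_le_exp (a - Real.log s)
    rw [Real.exp_sub, Real.exp_log hs, le_div_iff₀ hs] at h
    linarith

/-- The equality case of the Fenchel–Young inequality for the entropy function. -/
lemma eq_exp_of_mul_sub_exp_eq {s a : ℝ} (hs : 0 ≤ s)
    (h : a * s - Real.exp a = s * (Real.log s - 1)) : s = Real.exp a := by
  rcases hs.eq_or_lt with rfl | hs
  · simp at h
  · by_contra hne
    have hne' : a - Real.log s ≠ 0 := fun h0 => hne (by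
      rw [sub_eq_zero.1 h0, Real.exp_log hs])
    have h1 := Real.add_one_lt_exp hne'
    rw [Real.exp_sub, Real.exp_log hs, lt_div_iff₀ hs] at h1
    linarith

lemma continuous_entropyReal : Continuous (entropyReal : (X × Y → ℝ) → ℝ) := by
  have h : (entropyReal : (X × Y → ℝ) → ℝ) =
      fun γ => ∑ p, (γ p * Real.log (γ p) - γ p) := by
    funext γ
    exact Finset.sum_congr rfl fun p _ => by ring
  rw [h]
  refine continuous_finsetSum _ fun p _ => ?_
  exact (Real.continuous_mul_log.comp (continuous_apply p)).sub (continuous_apply p)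

lemma apply_le_entropyReal {γ : X × Y → ℝ} (h : ∀ p, 0 ≤ γ p) (p : X × Y) :
    γ p ≤ entropyReal γ + Fintype.card (X × Y) + Real.exp 1 := by
  classical
  have h1 : ∀ q, -1 ≤ γ q * (Real.log (γ q) - 1) := fun q => by
    simpa using mul_sub_exp_le (h q) 0
  have h2 : γ p - Real.exp 1 ≤ γ p * (Real.log (γ p) - 1) := by
    simpa using mul_sub_exp_le (h p) 1
  have h3 : γ p * (Real.log (γ p) - 1) + 1 ≤ ∑ q, (γ q * (Real.log (γ q) - 1) + 1) :=
    Finset.single_le_sum (f := fun q => γ q * (Real.log (γ q) - 1) + 1)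
      (fun q _ => by linarith [h1 q]) (Finset.mem_univ p)
  rw [Finset.sum_add_distrib] at h3
  simp only [Finset.sum_const, Finset.card_univ, nsmul_eq_mul, mul_one] at h3
  unfold entropyReal
  linarith

lemma neg_card_le_entropyReal {γ : X × Y → ℝ} (h : ∀ p, 0 ≤ γ p) :
    -(Fintype.card (X × Y) : ℝ) ≤ entropyReal γ := by
  have h3 : ∑ _q : X × Y, (-1 : ℝ) ≤ entropyReal γ :=
    Finset.sum_le_sum fun q _ => by simpa using mul_sub_exp_le (h q) 0
  simpa using h3

lemma norm_le_of_entropyReal_le {γ : X × Y → ℝ} (h : ∀ p, 0 ≤ γ p) {b : ℝ}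
    (hb : entropyReal γ ≤ b) : ‖γ‖ ≤ |b + Fintype.card (X × Y) + Real.exp 1| := by
  refine (pi_norm_le_iff_of_nonneg (abs_nonneg _)).2 fun p => ?_
  rw [Real.norm_eq_abs, abs_of_nonneg (h p)]
  refine le_trans ?_ (le_abs_self _)
  linarith [apply_le_entropyReal h p]

lemma entropyReal_midpoint_lt {γ γ' : X × Y → ℝ} (h : ∀ p, 0 ≤ γ p) (h' : ∀ p, 0 ≤ γ' p)
    (hne : γ ≠ γ') :
    entropyReal ((1 / 2 : ℝ) • γ + (1 / 2 : ℝ) • γ') <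
      1 / 2 * entropyReal γ + 1 / 2 * entropyReal γ' := by
  obtain ⟨p, hp⟩ := Function.ne_iff.1 hne
  unfold entropyReal
  rw [Finset.mul_sum, Finset.mul_sum, ← Finset.sum_add_distrib]
  refine Finset.sum_lt_sum (fun q _ => ?_) ⟨p, Finset.mem_univ p, ?_⟩
  · have := Real.strictConvexOn_mul_log.convexOn.2 (h q) (h' q)
      (by norm_num : (0 : ℝ) ≤ 1 / 2) (by norm_num : (0 : ℝ) ≤ 1 / 2) (by norm_num)
    simp only [Pi.add_apply, Pi.smul_apply, smul_eq_mul] at this ⊢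
    linarith
  · have := Real.strictConvexOn_mul_log.2 (h p) (h' p) hp
      (by norm_num : (0 : ℝ) < 1 / 2) (by norm_num : (0 : ℝ) < 1 / 2) (by norm_num)
    simp only [Pi.add_apply, Pi.smul_apply, smul_eq_mul] at this ⊢
    linarith

lemma continuous_margA : Continuous (margA : (X × Y → ℝ) → (X → ℝ) × (Y → ℝ)) := by
  unfold margA
  fun_prop

lemma continuous_dotP (c : X × Y → ℝ) : Continuous (dotP c) := by
  unfold dotP
  fun_prop

lemma continuous_dotE (η : (X → ℝ) × (Y → ℝ)) : Continuous fun v => dotE v η := by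
  unfold dotE
  fun_prop

lemma dotE_neg_right (u v : (X → ℝ) × (Y → ℝ)) : dotE u (-v) = -dotE u v := by
  simp [dotE]
  ring

lemma margA_combo (a b : ℝ) (γ γ' : X × Y → ℝ) :
    margA (a • γ + b • γ') = a • margA γ + b • margA γ' := by
  ext <;> simp [margA, Finset.sum_add_distrib, Finset.mul_sum]

lemma dotP_combo (a b : ℝ) (c γ γ' : X × Y → ℝ) :
    dotP c (a • γ + b • γ') = a * dotP c γ + b * dotP c γ' := by
  simp only [dotP, Finset.mul_sum, ← Finset.sum_add_distrib, Pi.add_apply, Pi.smul_apply,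
    smul_eq_mul]
  exact Finset.sum_congr rfl fun p _ => by ring

/-- `adjA` is the adjoint of `margA`. -/
lemma dotE_margA (γ : X × Y → ℝ) (ξ : (X → ℝ) × (Y → ℝ)) :
    dotE (margA γ) ξ = ∑ p, γ p * adjA ξ p := by
  simp only [dotE, margA, adjA, mul_add, Finset.sum_add_distrib, Finset.sum_mul]
  rw [Fintype.sum_prod_type, Fintype.sum_prod_type_right]

lemma dotE_left_injective {u v : (X → ℝ) × (Y → ℝ)} (h : ∀ k, dotE u k = dotE v k) : u = v := by
  classical
  ext i
  · simpa [dotE, Pi.single_apply] using h (Pi.single i 1, 0)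
  · simpa [dotE, Pi.single_apply] using h (0, Pi.single i 1)

lemma apply_le_norm_margA {γ : X × Y → ℝ} (h : ∀ p, 0 ≤ γ p) (p : X × Y) :
    γ p ≤ ‖margA γ‖ := by
  have h1 : γ p ≤ (margA γ).1 p.1 :=
    Finset.single_le_sum (f := fun y => γ (p.1, y)) (fun y _ => h _) (Finset.mem_univ p.2)
  exact h1.trans ((le_abs_self _).trans ((norm_le_pi_norm (margA γ).1 p.1).trans
    (norm_fst_le (margA γ))))

lemma abs_dotE_le (v η : (X → ℝ) × (Y → ℝ)) :
    |dotE v η| ≤ (∑ x, |η.1 x| + ∑ y, |η.2 y|) * ‖v‖ := by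
  unfold dotE
  refine (abs_add_le _ _).trans ?_
  rw [add_mul, Finset.sum_mul, Finset.sum_mul]
  refine add_le_add ((Finset.abs_sum_le_sum_abs _ _).trans (Finset.sum_le_sum fun i _ => ?_))
    ((Finset.abs_sum_le_sum_abs _ _).trans (Finset.sum_le_sum fun i _ => ?_))
  · rw [abs_mul, mul_comm]
    exact mul_le_mul_of_nonneg_left ((norm_le_pi_norm v.1 i).trans (norm_fst_le v)) (abs_nonneg _)
  · rw [abs_mul, mul_comm]
    exact mul_le_mul_of_nonneg_left ((norm_le_pi_norm v.2 i).trans (norm_snd_le v)) (abs_nonneg _)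

lemma LowerSemicontinuous.coe_add_ereal {α : Type*} [TopologicalSpace α] {f : α → ℝ}
    {g : α → EReal} (hf : Continuous f) (hg : LowerSemicontinuous g) :
    LowerSemicontinuous fun x => ((f x : ℝ) : EReal) + g x := by
  refine LowerSemicontinuous.add' (continuous_coe_real_ereal.comp hf).lowerSemicontinuous hg
    fun x => EReal.continuousAt_add (Or.inl ?_) (Or.inl ?_) <;> simp

/-- A lower semicontinuous function attains its minimum on a closed set that meets one of its
sublevel sets in a nonempty bounded set. -/
lemma LowerSemicontinuous.exists_forall_le_of_norm_le {V : Type*} [NormedAddCommGroup V]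
    [ProperSpace V] {f : V → EReal} (hf : LowerSemicontinuous f) {K : Set V} (hK : IsClosed K)
    {x₀ : V} (hx₀ : x₀ ∈ K) {R : ℝ} (hR : ∀ x ∈ K, f x < f x₀ → ‖x‖ ≤ R) :
    ∃ x ∈ K, ∀ y ∈ K, f x ≤ f y := by
  have hx₀' : x₀ ∈ Metric.closedBall (0 : V) (max R ‖x₀‖) ∩ K := by simp [hx₀]
  obtain ⟨x, hx, hmin⟩ := LowerSemicontinuousOn.exists_isMinOn ⟨x₀, hx₀'⟩
    ((isCompact_closedBall (0 : V) (max R ‖x₀‖)).inter_right hK) (hf.lowerSemicontinuousOn _)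
  refine ⟨x, hx.2, fun y hy => ?_⟩
  by_cases hlt : f y < f x₀
  · exact hmin ⟨by simpa using Or.inl (hR y hy hlt), hy⟩
  · exact (hmin hx₀').trans (not_lt.1 hlt)

lemma lowerSemicontinuous_transportCost {F : (X → ℝ) × (Y → ℝ) → EReal}
    (hF : LowerSemicontinuous F) (c : X × Y → ℝ) : LowerSemicontinuous (transportCost F c) :=
  LowerSemicontinuous.coe_add_ereal (continuous_dotP c) (hF.comp continuous_margA)

lemma margA_zero : margA (0 : X × Y → ℝ) = 0 := by
  ext <;> simp [margA]

lemma dotP_zero (c : X × Y → ℝ) : dotP c 0 = 0 := by simp [dotP]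

/-- The unbalanced transport problem has a minimizer. -/
lemma exists_transportCost_le {F : (X → ℝ) × (Y → ℝ) → EReal} {c : X × Y → ℝ}
    (hc : ∀ p, 0 ≤ c p) (hF1 : H1 F) (hF3 : H3 F) (hF4 : H4 F) :
    ∃ γ : X × Y → ℝ, (∀ p, 0 ≤ γ p) ∧
      ∀ γ' : X × Y → ℝ, (∀ p, 0 ≤ γ' p) → transportCost F c γ ≤ transportCost F c γ' := by
  obtain ⟨f₀, hf₀⟩ := EReal.exists_eq_coe (hF1.1 0) hF4.zero_ne_top
  obtain ⟨R, hR⟩ := hF3 1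
  refine (lowerSemicontinuous_transportCost hF1.2.2.2 c).exists_forall_le_of_norm_le
    isClosed_setOf_forall_nonneg (x₀ := 0) (fun _ => le_rfl) (R := max R |f₀|) fun γ hγ hlt => ?_
  have hdot : 0 ≤ dotP c γ := Finset.sum_nonneg fun p _ => mul_nonneg (hc p) (hγ p)
  simp only [transportCost, dotP_zero, margA_zero, hf₀, EReal.coe_zero, zero_add] at hlt
  have hlt' : F (margA γ) < (f₀ : EReal) := lt_of_le_of_lt
    (le_add_of_nonneg_left (EReal.coe_nonneg.2 hdot)) hlt
  have hA : ‖margA γ‖ ≤ max R |f₀| := by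
    by_contra! hgt
    have h1 := (hR _ ((le_max_left _ _).trans hgt.le)).trans_lt hlt'
    rw [EReal.coe_lt_coe_iff] at h1
    linarith [(le_abs_self f₀).trans (le_max_right R |f₀|)]
  refine (pi_norm_le_iff_of_nonneg ((norm_nonneg _).trans hA)).2 fun p => ?_
  rw [Real.norm_eq_abs, abs_of_nonneg (hγ p)]
  exact (apply_le_norm_margA hγ p).trans hA

lemma transportCost_combo_le {F : (X → ℝ) × (Y → ℝ) → EReal} {c : X × Y → ℝ} (hF1 : H1 F)
    {γ γ' : X × Y → ℝ} {m : ℝ} (h : transportCost F c γ ≤ m) (h' : transportCost F c γ' ≤ m)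
    {a b : ℝ} (ha : 0 ≤ a) (hb : 0 ≤ b) (hab : a + b = 1) :
    transportCost F c (a • γ + b • γ') ≤ m := by
  have hfin : ∀ δ, transportCost F c δ ≤ m → F (margA δ) ≠ ⊤ := fun δ hδ htop => by
    simp [transportCost, htop] at hδ
  obtain ⟨f, hf⟩ := EReal.exists_eq_coe (hF1.1 _) (hfin γ h)
  obtain ⟨f', hf'⟩ := EReal.exists_eq_coe (hF1.1 _) (hfin γ' h')
  have hconv := hF1.2.2.1 (margA γ) (margA γ') a b ha hb hab
  rw [← margA_combo, hf, hf'] at hconv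
  rw [transportCost, hf] at h
  rw [transportCost, hf'] at h'
  norm_cast at h h' hconv
  refine (add_le_add_right hconv _).trans ?_
  rw [dotP_combo]
  norm_cast
  have := add_le_add (mul_le_mul_of_nonneg_left h ha) (mul_le_mul_of_nonneg_left h' hb)
  rw [← add_mul, hab] at this
  linarith

/-- Among the minimizers of the unbalanced transport problem there is one of minimal entropy. -/
lemma exists_minimal_entropy {F : (X → ℝ) × (Y → ℝ) → EReal} {c : X × Y → ℝ}
    (hc : ∀ p, 0 ≤ c p) (hF1 : H1 F) (hF3 : H3 F) (hF4 : H4 F) :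
    ∃ (γs : X × Y → ℝ) (m : ℝ), (∀ p, 0 ≤ γs p) ∧ transportCost F c γs = m ∧
      (∀ γ : X × Y → ℝ, (∀ p, 0 ≤ γ p) → (m : EReal) ≤ transportCost F c γ) ∧
      ∀ γ : X × Y → ℝ, (∀ p, 0 ≤ γ p) → transportCost F c γ ≤ m →
        entropyReal γs ≤ entropyReal γ ∧ (entropyReal γ ≤ entropyReal γs → γ = γs) := by
  obtain ⟨γ₀, hγ₀, hmin⟩ := exists_transportCost_le hc hF1 hF3 hF4
  have hne_top : transportCost F c γ₀ ≠ ⊤ := ne_top_of_le_ne_top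
    (by simpa [transportCost, dotP_zero, margA_zero] using hF4.zero_ne_top)
    (hmin 0 fun _ => le_rfl)
  have hne_bot : transportCost F c γ₀ ≠ ⊥ := by
    simpa [transportCost, EReal.add_eq_bot_iff] using hF1.1 _
  obtain ⟨m, hm⟩ := EReal.exists_eq_coe hne_bot hne_top
  rw [hm] at hmin
  have hcl : IsClosed {γ : X × Y → ℝ | (∀ p, 0 ≤ γ p) ∧ transportCost F c γ ≤ m} :=
    isClosed_setOf_forall_nonneg.inter
      ((lowerSemicontinuous_transportCost hF1.2.2.2 c).isClosed_preimage m)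
  obtain ⟨γs, ⟨hs, hsm⟩, hse⟩ :=
    (continuous_coe_real_ereal.comp
      (continuous_entropyReal (X := X) (Y := Y))).lowerSemicontinuous.exists_forall_le_of_norm_le
    hcl (x₀ := γ₀) ⟨hγ₀, hm.le⟩ fun γ hγ hlt =>
      norm_le_of_entropyReal_le hγ.1 (EReal.coe_lt_coe_iff.1 hlt).le
  refine ⟨γs, m, hs, le_antisymm hsm (hmin γs hs), hmin, fun γ hγ hγm =>
    ⟨EReal.coe_le_coe_iff.1 (hse γ ⟨hγ, hγm⟩), fun hle => ?_⟩⟩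
  by_contra hne
  have hlt := entropyReal_midpoint_lt hγ hs hne
  have hmid := EReal.coe_le_coe_iff.1 (hse ((1 / 2 : ℝ) • γ + (1 / 2 : ℝ) • γs)
    ⟨fun p => by
      have := hγ p
      have := hs p
      simp only [Pi.add_apply, Pi.smul_apply, smul_eq_mul]
      positivity, transportCost_combo_le hF1 hγm hsm (by norm_num) (by norm_num) (by norm_num)⟩)
  linarith

lemma Ct_eq_of_nonneg (F : (X → ℝ) × (Y → ℝ) → EReal) (c : X × Y → ℝ) (t : ℝ) {γ : X × Y → ℝ}
    (h : ∀ p, 0 ≤ γ p) :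
    Ct F c t γ = transportCost F c γ + ((1 / t * entropyReal γ : ℝ) : EReal) := by
  rw [Ct, ent_eq_coe h, transportCost, ← EReal.coe_mul]

lemma Ct_zero_ne_top {F : (X → ℝ) × (Y → ℝ) → EReal} (hF4 : H4 F) (c : X × Y → ℝ) (t : ℝ) :
    Ct F c t 0 ≠ ⊤ := by
  rw [Ct_eq_of_nonneg F c t (γ := 0) fun _ => le_rfl, transportCost, margA_zero]
  exact EReal.add_ne_top (EReal.add_ne_top (EReal.coe_ne_top _) hF4.zero_ne_top)
    (EReal.coe_ne_top _)

lemma nonneg_of_Ct_ne_top {F : (X → ℝ) × (Y → ℝ) → EReal} (hF1 : H1 F) {c : X × Y → ℝ} {t : ℝ}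
    (ht : 0 < t) {γ : X × Y → ℝ} (h : Ct F c t γ ≠ ⊤) :
    (∀ p, 0 ≤ γ p) ∧ ∃ f : ℝ, F (margA γ) = f := by
  have hbot : ((dotP c γ : ℝ) : EReal) + F (margA γ) ≠ ⊥ := by
    simpa [EReal.add_eq_bot_iff] using hF1.1 _
  have hpos : ∀ p, 0 ≤ γ p := by
    by_contra hneg
    refine h ?_
    rw [Ct, ent_eq_top hneg, EReal.coe_mul_top_of_pos (by positivity),
      EReal.add_top_of_ne_bot hbot]
  refine ⟨hpos, EReal.exists_eq_coe (hF1.1 _) fun htop => h ?_⟩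
  rw [Ct_eq_of_nonneg F c t hpos, transportCost, htop,
    EReal.add_top_of_ne_bot (EReal.coe_ne_bot _), EReal.top_add_coe]

/-- Minimizers of the regularized problems converge to the transport minimizer of minimal
entropy. -/
lemma tendsto_of_minimal_entropy {F : (X → ℝ) × (Y → ℝ) → EReal} {c : X × Y → ℝ}
    (hF1 : H1 F) (hF4 : H4 F) {gam : ℝ → X × Y → ℝ}
    (hgam : ∀ t : ℝ, 0 < t → ∀ γ : X × Y → ℝ, Ct F c t (gam t) ≤ Ct F c t γ)
    {γs : X × Y → ℝ} {m : ℝ} (hs : ∀ p, 0 ≤ γs p) (hsm : transportCost F c γs = m)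
    (hmin : ∀ γ : X × Y → ℝ, (∀ p, 0 ≤ γ p) → (m : EReal) ≤ transportCost F c γ)
    (huniq : ∀ γ : X × Y → ℝ, (∀ p, 0 ≤ γ p) → transportCost F c γ ≤ m →
      entropyReal γ ≤ entropyReal γs → γ = γs) :
    Tendsto gam atTop (𝓝 γs) := by
  set N : ℝ := entropyReal γs + Fintype.card (X × Y) with hN
  have key : ∀ t, 0 < t → (∀ p, 0 ≤ gam t p) ∧ entropyReal (gam t) ≤ entropyReal γs ∧
      transportCost F c (gam t) ≤ ((m + 1 / t * N : ℝ) : EReal) := by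
    intro t ht
    obtain ⟨hpos, f, hf⟩ := nonneg_of_Ct_ne_top hF1 ht
      (ne_top_of_le_ne_top (Ct_zero_ne_top hF4 c t) (hgam t ht 0))
    have h1 := hgam t ht γs
    have h2 := hmin _ hpos
    have h3 := neg_card_le_entropyReal hpos
    rw [Ct_eq_of_nonneg F c t hpos, Ct_eq_of_nonneg F c t hs, hsm] at h1
    simp only [transportCost, hf] at h1 h2 ⊢
    norm_cast at h1 h2
    have ht' : 0 < 1 / t := by positivity
    refine ⟨hpos, ?_, ?_⟩
    · exact le_of_mul_le_mul_left (by linarith) ht'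
    · norm_cast
      have := mul_le_mul_of_nonneg_left h3 ht'.le
      rw [hN, mul_add]
      linarith
  have hev : ∀ᶠ t : ℝ in atTop, 0 < t := eventually_gt_atTop 0
  refine (isCompact_closedBall (0 : X × Y → ℝ)
    |entropyReal γs + Fintype.card (X × Y) + Real.exp 1|).tendsto_nhds_of_unique_mapClusterPt
    (hev.mono fun t ht => by
      simpa using norm_le_of_entropyReal_le (key t ht).1 (key t ht).2.1) fun γ _ hγ => ?_
  have hmem : ∀ {s : Set (X × Y → ℝ)}, IsClosed s → (∀ t, 0 < t → gam t ∈ s) → γ ∈ s :=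
    fun {s} hcl h => hcl.mem_of_mapClusterPt hγ (hev.mono h)
  refine huniq γ (hmem isClosed_setOf_forall_nonneg fun t ht => (key t ht).1) ?_
    (hmem (isClosed_le continuous_entropyReal continuous_const) fun t ht => (key t ht).2.1)
  by_contra! hlt
  obtain ⟨b, hmb, hb⟩ := EReal.lt_iff_exists_real_btwn.1 hlt
  have hfreq := hγ.frequently ((lowerSemicontinuous_transportCost hF1.2.2.2 c) γ b hb)
  have hlim : Tendsto (fun t : ℝ => m + 1 / t * N) atTop (𝓝 (m + 0 * N)) := by
    refine tendsto_const_nhds.add (Tendsto.mul_const N ?_)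
    exact (tendsto_inv_atTop_zero (𝕜 := ℝ)).congr fun t => (one_div t).symm
  rw [zero_mul, add_zero] at hlim
  obtain ⟨t, ht, ht0, htb⟩ := (hfreq.and_eventually (hev.and
    (hlim.eventually_lt_const (EReal.coe_lt_coe_iff.1 hmb)))).exists
  exact absurd (ht.trans_le (key t ht0).2.2) (not_lt.2 (EReal.coe_le_coe_iff.2 htb.le))

lemma dotE_smul_right (s : ℝ) (u v : (X → ℝ) × (Y → ℝ)) : dotE u (s • v) = s * dotE u v := by
  simp only [dotE, Prod.smul_fst, Prod.smul_snd, Pi.smul_apply, smul_eq_mul, mul_add,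
    Finset.mul_sum]
  exact congrArg₂ _ (Finset.sum_congr rfl fun i _ => by ring)
    (Finset.sum_congr rfl fun i _ => by ring)

lemma IsConjOf.dotE_sub_le {F : (X → ℝ) × (Y → ℝ) → EReal} {Fs : (X → ℝ) × (Y → ℝ) → ℝ}
    (hFs : IsConjOf F Fs) {v : (X → ℝ) × (Y → ℝ)} {f : ℝ} (hf : F v = f)
    (η : (X → ℝ) × (Y → ℝ)) : dotE v η - f ≤ Fs η := by
  have h : ((dotE v η : ℝ) : EReal) - F v ≤ conj F η :=
    le_iSup (fun v => ((dotE v η : ℝ) : EReal) - F v) v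
  rw [← hFs η, hf] at h
  exact_mod_cast h

/-- By superlinearity the supremum defining the conjugate is attained. -/
lemma IsConjOf.exists_eq {F : (X → ℝ) × (Y → ℝ) → EReal} {Fs : (X → ℝ) × (Y → ℝ) → ℝ}
    (hF1 : H1 F) (hF3 : H3 F) (hF4 : H4 F) (hFs : IsConjOf F Fs) (η : (X → ℝ) × (Y → ℝ)) :
    ∃ (v : (X → ℝ) × (Y → ℝ)) (f : ℝ), F v = f ∧ Fs η = dotE v η - f := by
  obtain ⟨f₀, hf₀⟩ := EReal.exists_eq_coe (hF1.1 0) hF4.zero_ne_top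
  set C : ℝ := ∑ x, |η.1 x| + ∑ y, |η.2 y|
  obtain ⟨R, hR⟩ := hF3 (C + 1)
  have hzero : dotE (0 : (X → ℝ) × (Y → ℝ)) η = 0 := by simp [dotE]
  have hlsc : LowerSemicontinuous fun v => ((-dotE v η : ℝ) : EReal) + F v :=
    LowerSemicontinuous.coe_add_ereal (continuous_dotE η).neg hF1.2.2.2
  obtain ⟨v, -, hv⟩ := hlsc.exists_forall_le_of_norm_le isClosed_univ (x₀ := 0)
    (Set.mem_univ _) (R := max R |f₀|) fun v _ hlt => by
      by_contra! hgt
      have hfin : F v ≠ ⊤ := fun htop => by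
        simp [htop] at hlt
      obtain ⟨f, hf⟩ := EReal.exists_eq_coe (hF1.1 v) hfin
      have h1 := hR v ((le_max_left _ _).trans hgt.le)
      rw [hf] at h1
      rw [hzero, hf, hf₀, neg_zero] at hlt
      norm_cast at h1 hlt
      have h2 : dotE v η ≤ C * ‖v‖ := (le_abs_self _).trans (abs_dotE_le v η)
      have h3 := (le_abs_self f₀).trans (le_max_right R |f₀|)
      linarith
  have hfin : F v ≠ ⊤ := fun htop => by
    have := hv 0 (Set.mem_univ _)
    rw [hf₀, htop, EReal.add_top_of_ne_bot (EReal.coe_ne_bot _), top_le_iff,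
      ← EReal.coe_add] at this
    exact EReal.coe_ne_top _ this
  obtain ⟨f, hf⟩ := EReal.exists_eq_coe (hF1.1 v) hfin
  refine ⟨v, f, hf, le_antisymm ?_ (hFs.dotE_sub_le hf η)⟩
  rw [← EReal.coe_le_coe_iff, hFs η]
  refine iSup_le fun w => ?_
  by_cases hw : F w = ⊤
  · simp [hw]
  · obtain ⟨g, hg⟩ := EReal.exists_eq_coe (hF1.1 w) hw
    have := hv w (Set.mem_univ _)
    rw [hf, hg] at this
    rw [hg]
    norm_cast at this ⊢
    linarith

lemma fderiv_eq_dotE_of_subgradient {Fs : (X → ℝ) × (Y → ℝ) → ℝ} {ξ₀ g : (X → ℝ) × (Y → ℝ)}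
    (hd : DifferentiableAt ℝ Fs ξ₀) (h : ∀ ξ, Fs ξ₀ + dotE g (ξ - ξ₀) ≤ Fs ξ)
    (k : (X → ℝ) × (Y → ℝ)) : fderiv ℝ Fs ξ₀ k = dotE g k := by
  have h1 : HasDerivAt (fun s : ℝ => Fs (ξ₀ + s • k)) (fderiv ℝ Fs ξ₀ k) 0 :=
    hd.hasFDerivAt.hasLineDerivAt k
  have h2 : HasDerivAt (fun s : ℝ => Fs (ξ₀ + s • k) - s * dotE g k)
      (fderiv ℝ Fs ξ₀ k - 1 * dotE g k) 0 := h1.sub ((hasDerivAt_id 0).mul_const _)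
  have hmin : IsLocalMin (fun s : ℝ => Fs (ξ₀ + s • k) - s * dotE g k) 0 :=
    Filter.Eventually.of_forall fun s => by
      have := h (ξ₀ + s • k)
      rw [add_sub_cancel_left, dotE_smul_right] at this
      simp only [zero_smul, add_zero, zero_mul, sub_zero]
      linarith
  linarith [hmin.hasDerivAt_eq_zero h2]

/-- The gradient in `ξ` of the regularized dual functional, jointly in `(t, ξ)`. -/
noncomputable def dualGrad (Fs : (X → ℝ) × (Y → ℝ) → ℝ) (c : X × Y → ℝ)
    (u : ℝ × ((X → ℝ) × (Y → ℝ))) : ((X → ℝ) × (Y → ℝ)) →L[ℝ] ℝ :=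
  -fderiv ℝ Fs (-u.2) + ∑ p, Real.exp (u.1 * (adjAEval p u.2 - c p)) • adjAEval p

lemma dualGrad_apply (Fs : (X → ℝ) × (Y → ℝ) → ℝ) (c : X × Y → ℝ) (t : ℝ)
    (ξ k : (X → ℝ) × (Y → ℝ)) :
    dualGrad Fs c (t, ξ) k =
      -fderiv ℝ Fs (-ξ) k + ∑ p, Real.exp (t * (adjA ξ p - c p)) * adjA k p := by
  simp [dualGrad, adjAEval_apply]

lemma contDiff_dualGrad {Fs : (X → ℝ) × (Y → ℝ) → ℝ} (hF6 : ContDiff ℝ 2 Fs) (c : X × Y → ℝ) :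
    ContDiff ℝ 1 (dualGrad Fs c) := by
  have h : ContDiff ℝ 1 (fderiv ℝ Fs) := hF6.fderiv_right (by norm_num)
  unfold dualGrad
  refine (h.comp contDiff_snd.neg).neg.add (ContDiff.sum fun p _ => ?_)
  exact (contDiff_fst.mul (((adjAEval p).contDiff.comp contDiff_snd).sub
    contDiff_const)).exp.smul contDiff_const

lemma hasFDerivAt_KtR {Fs : (X → ℝ) × (Y → ℝ) → ℝ} (hd : Differentiable ℝ Fs) (c : X × Y → ℝ)
    {t : ℝ} (ht : t ≠ 0) (ξ : (X → ℝ) × (Y → ℝ)) :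
    HasFDerivAt (KtR Fs c t) (dualGrad Fs c (t, ξ)) ξ := by
  have h1 : HasFDerivAt (fun ξ => Fs (-ξ)) (-fderiv ℝ Fs (-ξ)) ξ := by
    have := (hd (-ξ)).hasFDerivAt.comp ξ (hasFDerivAt_id ξ).neg
    exact this.congr_fderiv (by ext <;> simp)
  have h2 : ∀ p : X × Y, HasFDerivAt (fun ξ => Real.exp (t * (adjAEval p ξ - c p)))
      (Real.exp (t * (adjAEval p ξ - c p)) • t • adjAEval p) ξ := fun p =>
    (((adjAEval p).hasFDerivAt.sub_const (c p)).const_mul t).exp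
  have h3 := h1.add ((HasFDerivAt.fun_sum (u := Finset.univ) fun p _ => h2 p).const_mul (1 / t))
  refine HasFDerivAt.congr_fderiv (f := KtR Fs c t) h3 ?_
  simp only [dualGrad, Finset.smul_sum]
  refine congrArg _ (Finset.sum_congr rfl fun p _ => ?_)
  rw [smul_comm _ t, smul_smul, one_div_mul_cancel ht, one_smul]

lemma continuous_KtR {Fs : (X → ℝ) × (Y → ℝ) → ℝ} (hd : Differentiable ℝ Fs) (c : X × Y → ℝ)
    {t : ℝ} (ht : t ≠ 0) : Continuous (KtR Fs c t) :=
  continuous_iff_continuousAt.2 fun ξ => (hasFDerivAt_KtR hd c ht ξ).continuousAt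

lemma dualGrad_monotone {Fs : (X → ℝ) × (Y → ℝ) → ℝ} (hF5 : H5 Fs) (hd : Differentiable ℝ Fs)
    (c : X × Y → ℝ) {t : ℝ} (ht : 0 < t) (ξ : (X → ℝ) × (Y → ℝ)) {k : (X → ℝ) × (Y → ℝ)}
    (hk : k ≠ 0) :
    ∃ lam > (0 : ℝ), ∀ᶠ s : ℝ in 𝓝[>] 0,
      lam * s ≤ dualGrad Fs c (t, ξ + s • k) k - dualGrad Fs c (t, ξ) k := by
  obtain ⟨r, hr, g, lam, hlam, hsub, hstrong⟩ := hF5 (-ξ)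
  have hg := fderiv_eq_dotE_of_subgradient (hd (-ξ)) hsub
  have hk' : 0 < ‖k‖ := norm_pos_iff.2 hk
  refine ⟨lam / 2 * ‖k‖ ^ 2, by positivity, ?_⟩
  filter_upwards [Ioo_mem_nhdsGT (div_pos hr hk')] with s hs
  obtain ⟨hs0, hsr⟩ := hs
  rw [lt_div_iff₀ hk'] at hsr
  have hA := hstrong (-(ξ + s • k)) (by
    rw [show -(ξ + s • k) - -ξ = -(s • k) by abel, norm_neg, norm_smul, Real.norm_eq_abs,
      abs_of_pos hs0]
    exact hsr.le)
  obtain ⟨-, -, g', -, -, hsub', -⟩ := hF5 (-(ξ + s • k))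
  have hB := hsub' (-ξ)
  rw [← hg, show -(ξ + s • k) - -ξ = -(s • k) by abel, norm_neg, norm_smul, Real.norm_eq_abs,
    abs_of_pos hs0, map_neg, map_smul, smul_eq_mul] at hA
  rw [← fderiv_eq_dotE_of_subgradient (hd _) hsub', show -ξ - -(ξ + s • k) = s • k by abel,
    map_smul, smul_eq_mul] at hB
  have hexp : ∑ p, Real.exp (t * (adjA ξ p - c p)) * adjA k p ≤
      ∑ p, Real.exp (t * (adjA (ξ + s • k) p - c p)) * adjA k p := by
    refine Finset.sum_le_sum fun p _ => ?_
    have hadj : adjA (ξ + s • k) p = adjA ξ p + s * adjA k p := by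
      simp only [← adjAEval_apply, map_add, map_smul, smul_eq_mul]
    rw [hadj]
    rcases le_total 0 (adjA k p) with h0 | h0
    · refine mul_le_mul_of_nonneg_right (Real.exp_le_exp.2 ?_) h0
      have := mul_nonneg hs0.le h0
      exact mul_le_mul_of_nonneg_left (by linarith) ht.le
    · refine mul_le_mul_of_nonpos_right (Real.exp_le_exp.2 ?_) h0
      have := mul_nonpos_of_nonneg_of_nonpos hs0.le h0
      exact mul_le_mul_of_nonneg_left (by linarith) ht.le
  rw [dualGrad_apply, dualGrad_apply]
  have hfd : lam / 2 * ‖k‖ ^ 2 * s ≤ fderiv ℝ Fs (-ξ) k - fderiv ℝ Fs (-(ξ + s • k)) k := by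
    refine le_of_mul_le_mul_left ?_ hs0
    nlinarith
  linarith

lemma isInvertible_fderiv_dualGrad {Fs : (X → ℝ) × (Y → ℝ) → ℝ} (hF5 : H5 Fs)
    (hF6 : ContDiff ℝ 2 Fs) (c : X × Y → ℝ) {t : ℝ} (ht : 0 < t) (ξ : (X → ℝ) × (Y → ℝ)) :
    (fderiv ℝ (dualGrad Fs c) (t, ξ) ∘L .inr ℝ ℝ ((X → ℝ) × (Y → ℝ))).IsInvertible := by
  have hL : HasFDerivAt (dualGrad Fs c) (fderiv ℝ (dualGrad Fs c) (t, ξ)) (t, ξ) :=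
    ((contDiff_dualGrad hF6 c).differentiable (by norm_num) _).hasFDerivAt
  have hinj : Function.Injective
      (fderiv ℝ (dualGrad Fs c) (t, ξ) ∘L .inr ℝ ℝ ((X → ℝ) × (Y → ℝ))) := by
    refine (injective_iff_map_eq_zero _).2 fun k hk0 => ?_
    by_contra hk
    obtain ⟨lam, hlam, hev⟩ :=
      dualGrad_monotone hF5 (hF6.differentiable (by norm_num)) c ht ξ hk
    have h1 : HasDerivAt (fun s : ℝ => dualGrad Fs c ((t, ξ) + s • ((0 : ℝ), k)))
        (fderiv ℝ (dualGrad Fs c) (t, ξ) (0, k)) 0 := hL.hasLineDerivAt (0, k)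
    have h2 := ((ContinuousLinearMap.apply ℝ ℝ k).hasFDerivAt.comp_hasDerivAt (0 : ℝ)
      h1).tendsto_slope_zero_right
    have h3 : lam ≤ fderiv ℝ (dualGrad Fs c) (t, ξ) (0, k) k := by
      refine ge_of_tendsto h2 ?_
      filter_upwards [hev, self_mem_nhdsWithin] with s hs hs0
      rw [Set.mem_Ioi] at hs0
      simpa [inv_mul_eq_div, le_div_iff₀ hs0] using hs
    have h4 : fderiv ℝ (dualGrad Fs c) (t, ξ) (0, k) = 0 := hk0
    rw [h4] at h3
    exact absurd hlam (not_lt.2 (by simpa using h3))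
  have hdim : Module.finrank ℝ ((X → ℝ) × (Y → ℝ)) =
      Module.finrank ℝ (((X → ℝ) × (Y → ℝ)) →L[ℝ] ℝ) := by
    rw [← (LinearMap.toContinuousLinearMap (𝕜 := ℝ) (E := (X → ℝ) × (Y → ℝ))
      (F' := ℝ)).finrank_eq]
    exact Subspace.dual_finrank_eq.symm
  refine ⟨(LinearMap.linearEquivOfInjective _ hinj hdim).toContinuousLinearEquiv,
    ContinuousLinearMap.ext fun _ => rfl⟩

/-- The regularized dual problem has a critical point. -/
lemma exists_dualGrad_eq_zero [Nonempty X] [Nonempty Y] {F : (X → ℝ) × (Y → ℝ) → EReal}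
    {Fs : (X → ℝ) × (Y → ℝ) → ℝ} (hF1 : H1 F) (hF4 : H4 F) (hFs : IsConjOf F Fs)
    (hd : Differentiable ℝ Fs) (c : X × Y → ℝ) {t : ℝ} (ht : 0 < t) :
    ∃ ξ, dualGrad Fs c (t, ξ) = 0 := by
  classical
  obtain ⟨f₀, hf₀⟩ := EReal.exists_eq_coe (hF1.1 0) hF4.zero_ne_top
  obtain ⟨W, hW, hdom⟩ := hF4
  obtain ⟨ε, hε, hball⟩ := Metric.nhds_basis_closedBall.mem_iff.1 hW
  have hX : ∀ x : X, ∃ f : ℝ, F (Pi.single x ε, 0) = f := fun x => by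
    refine EReal.exists_eq_coe (hF1.1 _) (hdom _ (hball ?_) (fun i => ?_) fun _ => le_rfl)
    · simp [Prod.norm_def, Pi.norm_single, abs_of_pos hε, hε.le]
    · by_cases h : i = x <;> simp [h, hε.le]
  have hY : ∀ y : Y, ∃ f : ℝ, F (0, Pi.single y ε) = f := fun y => by
    refine EReal.exists_eq_coe (hF1.1 _) (hdom _ (hball ?_) (fun _ => le_rfl) fun i => ?_)
    · simp [Prod.norm_def, Pi.norm_single, abs_of_pos hε, hε.le]
    · by_cases h : i = y <;> simp [h, hε.le]
  choose fX hfX using hX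
  choose fY hfY using hY
  set M : ℝ := KtR Fs c t 0
  set B : ℝ := ∑ x, |(M + fX x) / ε| + ∑ y, |(M + fY y) / ε|
  set D : ℝ := |M + f₀| + ∑ p, |c p|
  have hBX : ∀ x, |(M + fX x) / ε| ≤ B := fun x =>
    (Finset.single_le_sum (f := fun x => |(M + fX x) / ε|) (fun _ _ => abs_nonneg _)
      (Finset.mem_univ x)).trans
      (le_add_of_nonneg_right (Finset.sum_nonneg fun _ _ => abs_nonneg _))
  have hBY : ∀ y, |(M + fY y) / ε| ≤ B := fun y =>
    (Finset.single_le_sum (f := fun y => |(M + fY y) / ε|) (fun _ _ => abs_nonneg _)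
      (Finset.mem_univ y)).trans
      (le_add_of_nonneg_left (Finset.sum_nonneg fun _ _ => abs_nonneg _))
  have hB0 : 0 ≤ B := (abs_nonneg _).trans (hBX (Classical.arbitrary X))
  have hD0 : 0 ≤ D := by positivity
  have hbound : ∀ ξ, KtR Fs c t ξ < M → ‖ξ‖ ≤ B + D := by
    intro ξ hξ
    have hsum : 0 ≤ (1 / t) * ∑ p, Real.exp (t * (adjA ξ p - c p)) :=
      mul_nonneg (by positivity) (Finset.sum_nonneg fun _ _ => Real.exp_nonneg _)
    have hFsM : Fs (-ξ) ≤ M := by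
      rw [KtR] at hξ
      linarith
    have hlowX : ∀ x, -B ≤ ξ.1 x := fun x => by
      have h := hFs.dotE_sub_le (hfX x) (-ξ)
      have h2 : dotE (Pi.single x ε, 0) (-ξ) = -(ξ.1 x * ε) := by
        simp [dotE, Pi.single_apply, mul_comm]
      rw [h2] at h
      have h3 : -ξ.1 x ≤ (M + fX x) / ε := by
        rw [le_div_iff₀ hε]
        linarith
      linarith [(le_abs_self _).trans (hBX x)]
    have hlowY : ∀ y, -B ≤ ξ.2 y := fun y => by
      have h := hFs.dotE_sub_le (hfY y) (-ξ)
      have h2 : dotE (0, Pi.single y ε) (-ξ) = -(ξ.2 y * ε) := by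
        simp [dotE, Pi.single_apply, mul_comm]
      rw [h2] at h
      have h3 : -ξ.2 y ≤ (M + fY y) / ε := by
        rw [le_div_iff₀ hε]
        linarith
      linarith [(le_abs_self _).trans (hBY y)]
    have hup : ∀ x y, ξ.1 x + ξ.2 y ≤ D := fun x y => by
      have h := hFs.dotE_sub_le hf₀ (-ξ)
      have h0 : dotE (0 : (X → ℝ) × (Y → ℝ)) (-ξ) = 0 := by simp [dotE]
      rw [h0] at h
      have h1 : Real.exp (t * (adjA ξ (x, y) - c (x, y))) ≤
          ∑ p, Real.exp (t * (adjA ξ p - c p)) :=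
        Finset.single_le_sum (f := fun p => Real.exp (t * (adjA ξ p - c p)))
          (fun _ _ => Real.exp_nonneg _) (Finset.mem_univ (x, y))
      have h2 := Real.add_one_le_exp (t * (adjA ξ (x, y) - c (x, y)))
      have h3 : (1 / t) * ∑ p, Real.exp (t * (adjA ξ p - c p)) ≤ M + f₀ := by
        rw [KtR] at hξ
        linarith
      have h4 : (1 / t) * (t * (adjA ξ (x, y) - c (x, y))) ≤ M + f₀ :=
        (mul_le_mul_of_nonneg_left (by linarith) (by positivity)).trans h3
      rw [← mul_assoc, one_div_mul_cancel ht.ne', one_mul] at h4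
      have h5 : |c (x, y)| ≤ ∑ p, |c p| :=
        Finset.single_le_sum (f := fun p => |c p|) (fun _ _ => abs_nonneg _)
          (Finset.mem_univ (x, y))
      have h6 : adjA ξ (x, y) = ξ.1 x + ξ.2 y := rfl
      rw [h6] at h4
      linarith [le_abs_self (M + f₀), le_abs_self (c (x, y))]
    refine max_le ((pi_norm_le_iff_of_nonneg (by positivity)).2 fun x => ?_)
      ((pi_norm_le_iff_of_nonneg (by positivity)).2 fun y => ?_)
    · have := hup x (Classical.arbitrary Y)
      have := hlowY (Classical.arbitrary Y)
      exact abs_le.2 ⟨by linarith [hlowX x], by linarith⟩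
    · have := hup (Classical.arbitrary X) y
      have := hlowX (Classical.arbitrary X)
      exact abs_le.2 ⟨by linarith [hlowY y], by linarith⟩
  obtain ⟨ξ, -, hξ⟩ := (continuous_coe_real_ereal.comp
    (continuous_KtR hd c ht.ne')).lowerSemicontinuous.exists_forall_le_of_norm_le isClosed_univ
    (x₀ := 0) (Set.mem_univ _) fun ξ _ hlt => hbound ξ (EReal.coe_lt_coe_iff.1 hlt)
  have hmin : IsLocalMin (KtR Fs c t) ξ := Filter.Eventually.of_forall fun η =>
    EReal.coe_le_coe_iff.1 (hξ η (Set.mem_univ _))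
  exact ⟨ξ, hmin.hasFDerivAt_eq_zero (hasFDerivAt_KtR hd c ht.ne' ξ)⟩

/-- Minimizers of the regularized problem are determined by the critical points of the dual. -/
lemma eq_gibbs_of_dualGrad_eq_zero {F : (X → ℝ) × (Y → ℝ) → EReal}
    {Fs : (X → ℝ) × (Y → ℝ) → ℝ} (hF1 : H1 F) (hF3 : H3 F) (hF4 : H4 F) (hFs : IsConjOf F Fs)
    (hd : Differentiable ℝ Fs) {c : X × Y → ℝ} {t : ℝ} (ht : 0 < t)
    {ξ : (X → ℝ) × (Y → ℝ)} (hξ : dualGrad Fs c (t, ξ) = 0) {γ : X × Y → ℝ}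
    (hγ : ∀ γ' : X × Y → ℝ, Ct F c t γ ≤ Ct F c t γ') : γ = gibbs c t ξ := by
  have hpos : ∀ p, 0 ≤ gibbs c t ξ p := fun p => (Real.exp_pos _).le
  obtain ⟨v, f, hf, hv⟩ := hFs.exists_eq hF1 hF3 hF4 (-ξ)
  have hdotE_sub : ∀ a b : (X → ℝ) × (Y → ℝ), dotE v (a - b) = dotE v a - dotE v b := by
    intro a b
    simp only [dotE, Prod.fst_sub, Prod.snd_sub, Pi.sub_apply, mul_sub, Finset.sum_sub_distrib]
    ring
  have hvA : v = margA (gibbs c t ξ) := by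
    refine dotE_left_injective fun k => ?_
    have h1 := fderiv_eq_dotE_of_subgradient (g := v) (hd (-ξ)) (fun η => by
      have := hFs.dotE_sub_le hf η
      rw [hdotE_sub]
      linarith) k
    have h2 := congrArg (fun L => L k) hξ
    simp only [dualGrad_apply, zero_apply] at h2
    rw [dotE_margA, ← h1]
    simp only [gibbs]
    linarith
  obtain ⟨hγ0, f', hf'⟩ := nonneg_of_Ct_ne_top hF1 ht
    (ne_top_of_le_ne_top (Ct_zero_ne_top hF4 c t) (hγ 0))
  have h1 := hγ (gibbs c t ξ)
  rw [Ct_eq_of_nonneg F c t hγ0, Ct_eq_of_nonneg F c t hpos, transportCost, transportCost, hf',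
    ← hvA, hf] at h1
  norm_cast at h1
  have h2 := hFs.dotE_sub_le hf' (-ξ)
  rw [hv, hvA, dotE_neg_right, dotE_neg_right, dotE_margA, dotE_margA] at h2
  have hsum : ∀ δ : X × Y → ℝ, ∑ p, (δ p * (Real.log (δ p) - 1) -
      t * (adjA ξ p - c p) * δ p) =
      t * (dotP c δ - ∑ p, δ p * adjA ξ p + 1 / t * entropyReal δ) := by
    intro δ
    rw [mul_add, ← mul_assoc, mul_one_div_cancel ht.ne', one_mul, dotP, entropyReal,
      ← Finset.sum_sub_distrib, Finset.mul_sum, ← Finset.sum_add_distrib]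
    exact Finset.sum_congr rfl fun p _ => by ring
  have h3 : ∑ p, (γ p * (Real.log (γ p) - 1) - t * (adjA ξ p - c p) * γ p) ≤
      ∑ p, -Real.exp (t * (adjA ξ p - c p)) := by
    have h4 : ∑ p, -Real.exp (t * (adjA ξ p - c p)) =
        ∑ p, (gibbs c t ξ p * (Real.log (gibbs c t ξ p) - 1) -
          t * (adjA ξ p - c p) * gibbs c t ξ p) :=
      Finset.sum_congr rfl fun p _ => by
        rw [gibbs, Real.log_exp]
        ring
    rw [h4, hsum, hsum]
    exact mul_le_mul_of_nonneg_left (by linarith) ht.le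
  have hterm : ∀ p ∈ Finset.univ, -Real.exp (t * (adjA ξ p - c p)) ≤
      γ p * (Real.log (γ p) - 1) - t * (adjA ξ p - c p) * γ p := fun p _ => by
    linarith [mul_sub_exp_le (hγ0 p) (t * (adjA ξ p - c p))]
  have heq := (Finset.sum_eq_sum_iff_of_le hterm).1
    (le_antisymm (Finset.sum_le_sum hterm) h3)
  funext p
  exact eq_exp_of_mul_sub_exp_eq (hγ0 p) (by linarith [heq p (Finset.mem_univ p)])

/-- The trajectory of minimizers of the regularized problems is continuously differentiable. -/
lemma contDiffOn_minimizers [Nonempty X] [Nonempty Y] {F : (X → ℝ) × (Y → ℝ) → EReal}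
    {Fs : (X → ℝ) × (Y → ℝ) → ℝ} (hF1 : H1 F) (hF3 : H3 F) (hF4 : H4 F) (hFs : IsConjOf F Fs)
    (hF5 : H5 Fs) (hF6 : ContDiff ℝ 2 Fs) {c : X × Y → ℝ} {gam : ℝ → X × Y → ℝ}
    (hgam : ∀ t : ℝ, 0 < t → ∀ γ : X × Y → ℝ, Ct F c t (gam t) ≤ Ct F c t γ) :
    ContDiffOn ℝ 1 gam (Set.Ioi 0) := by
  have hd : Differentiable ℝ Fs := hF6.differentiable (by norm_num)
  intro t (ht : 0 < t)
  obtain ⟨ξ, hξ⟩ := exists_dualGrad_eq_zero hF1 hF4 hFs hd c ht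
  have hcd : ContDiffAt ℝ 1 (dualGrad Fs c) (t, ξ) := (contDiff_dualGrad hF6 c).contDiffAt
  have hinv := isInvertible_fderiv_dualGrad hF5 hF6 c ht ξ
  set ψ := hcd.implicitFunction one_ne_zero hinv
  have hψ : ContDiffAt ℝ 1 ψ t := hcd.contDiffAt_implicitFunction one_ne_zero hinv
  have hzero : ∀ᶠ s in 𝓝 t, dualGrad Fs c (s, ψ s) = dualGrad Fs c (t, ξ) :=
    hcd.eventually_apply_implicitFunction one_ne_zero hinv
  have hgibbs : ContDiffAt ℝ 1 (fun s => gibbs c s (ψ s)) t := by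
    refine contDiffAt_pi.2 fun p => ?_
    exact (contDiffAt_id.mul (((adjAEval p).contDiff.contDiffAt.comp t hψ).sub
      contDiffAt_const)).exp
  refine (hgibbs.congr_of_eventuallyEq ?_).contDiffWithinAt
  filter_upwards [hzero, lt_mem_nhds ht] with s hs hs0
  exact eq_gibbs_of_dualGrad_eq_zero hF1 hF3 hF4 hFs hd hs0 (hs.trans hξ) (hgam s hs0)

end EntropicTransport

/-- among the minimizers of the unbalanced OT problem there is a
unique one of minimal entropy, `γ*`; the trajectory of minimizers of `C_t`
converges to `γ*` as `t → +∞` and is `C¹` on `(0,∞)`. -/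
theorem statement12 {X Y : Type*} [Fintype X] [Fintype Y] [Nonempty X] [Nonempty Y]
    (c : X × Y → ℝ) (hc : ∀ p, 0 ≤ c p)
    (F : (X → ℝ) × (Y → ℝ) → EReal) (Fs : (X → ℝ) × (Y → ℝ) → ℝ)
    (hF1 : H1 F) (hF2 : H2 F) (hF3 : H3 F) (hF4 : H4 F)
    (hFs : IsConjOf F Fs) (hF5 : H5 Fs) (hF6 : ContDiff ℝ 2 Fs)
    (gam : ℝ → X × Y → ℝ)
    (hgam : ∀ t : ℝ, 0 < t → ∀ γ : X × Y → ℝ, Ct F c t (gam t) ≤ Ct F c t γ) :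
    ∃ γs : X × Y → ℝ,
      ((∀ p, 0 ≤ γs p) ∧
        ∀ γ : X × Y → ℝ, (∀ p, 0 ≤ γ p) →
          ((dotP c γs : ℝ) : EReal) + F (margA γs) ≤
            ((dotP c γ : ℝ) : EReal) + F (margA γ)) ∧
      (∀ γ' : X × Y → ℝ,
        ((∀ p, 0 ≤ γ' p) ∧
          ∀ γ : X × Y → ℝ, (∀ p, 0 ≤ γ p) →
            ((dotP c γ' : ℝ) : EReal) + F (margA γ') ≤
              ((dotP c γ : ℝ) : EReal) + F (margA γ)) →
        ent γs ≤ ent γ' ∧ (ent γ' ≤ ent γs → γ' = γs)) ∧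
      Filter.Tendsto gam Filter.atTop (nhds γs) ∧
      ContDiffOn ℝ 1 gam (Set.Ioi 0) := by
  obtain ⟨γs, m, hs, hsm, hmin, hent⟩ := exists_minimal_entropy hc hF1 hF3 hF4
  refine ⟨γs, ⟨hs, fun γ hγ => hsm.le.trans (hmin γ hγ)⟩, fun γ' hγ' => ?_,
    tendsto_of_minimal_entropy hF1 hF4 hgam hs hsm hmin fun γ hγ hγm => (hent γ hγ hγm).2,
    contDiffOn_minimizers hF1 hF3 hF4 hFs hF5 hF6 hgam⟩
  rw [ent_eq_coe hs, ent_eq_coe hγ'.1, EReal.coe_le_coe_iff, EReal.coe_le_coe_iff]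
  exact hent γ' hγ'.1 ((hγ'.2 γs hs).trans hsm.le)
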